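/- Let q₁,q₂,r₁,r₂ : ℝ² → ℂ be smooth and satisfy the zero-curvature equation ∂ₜU(ζ) − ∂ₓV(ζ) + U(ζ)V(ζ) − V(ζ)U(ζ) = 0 for all ζ ∈ ℂ. Fix ζ₂ ∈ ℂ, ζ₂ ≠ 0, and let the row vector (χ₁,χ₂,χ₃) be smooth with χ₁,χ₂ nowhere zero and satisfying −∂ₓ(χ₁,χ₂,χ₃) = (χ₁,χ₂,χ₃)U(ζ₂) and −∂ₜ(χ₁,χ₂,χ₃) = (χ₁,χ₂,χ₃)V(ζ₂). Let R₂ satisfy ∂ₓR₂ = r₂ and ∂ₜR₂ = −i∂ₓr₂ + (2/3)(r₁q₁ + r₂q₂)r₂. Define T₂(ζ) = [[âζ, 1, 0], [1, b̂ζ, ĉζ], [0, d̂ζ, ζ]] with â = −χ₂/(ζ₂χ₁), b̂ = −(χ₁ + ζ₂R₂χ₃)/(ζ₂χ₂), ĉ = −χ₃/χ₂, d̂ = R₂, and the transformed potentials q̂₁ = [q₁χ₁² + 3iζ₂χ₁χ₂ + ζ₂χ₁R₂(q₁χ₃ − χ₂q₂)]/χ₂², r̂₁ = [(r₁χ₂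 + r₂χ₃)χ₂ − 3iζ₂χ₁χ₂]/χ₁², r̂₂ = [(3iR₂ζ₂² − r₂)χ₁χ₂ − ζ₂χ₂R₂(r₁χ₂ + r₂χ₃)]/(ζ₂χ₁²), q̂₂ = (q₁χ₃ − q₂χ₂)ζ₂χ₁/χ₂². Then for every ζ ∈ ℂ, ∂ₜT₂(ζ) = V(ζ)T₂(ζ) − T₂(ζ)V̂(ζ), where V̂ is V with q₁,q₂,r₁,r₂ replaced by q̂₁,q̂₂,r̂₁,r̂₂. -/

import Mathlib

open Complex Matrix

noncomputable section

def pdx (f : ℝ → ℝ → ℂ) : ℝ → ℝ → ℂ := fun x t => deriv (fun x' => f x' t) x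

def pdt (f : ℝ → ℝ → ℂ) : ℝ → ℝ → ℂ := fun x t => deriv (fun t' => f x t') t

def Mpdx (F : ℝ → ℝ → Matrix (Fin 3) (Fin 3) ℂ) : ℝ → ℝ → Matrix (Fin 3) (Fin 3) ℂ :=
  fun x t => Matrix.of fun i j => deriv (fun x' => F x' t i j) x

def Mpdt (F : ℝ → ℝ → Matrix (Fin 3) (Fin 3) ℂ) : ℝ → ℝ → Matrix (Fin 3) (Fin 3) ℂ :=
  fun x t => Matrix.of fun i j => deriv (fun t' => F x t' i j) t

/-- x-derivative of a row-vector-valued function, componentwise. -/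
def vpdx (f : ℝ → ℝ → Fin 3 → ℂ) : ℝ → ℝ → Fin 3 → ℂ :=
  fun x t i => deriv (fun x' => f x' t i) x

/-- t-derivative of a row-vector-valued function, componentwise. -/
def vpdt (f : ℝ → ℝ → Fin 3 → ℂ) : ℝ → ℝ → Fin 3 → ℂ :=
  fun x t i => deriv (fun t' => f x t' i) t

/-- The spatial Lax matrix U(ζ). -/
def Umat (q1 q2 r1 r2 : ℝ → ℝ → ℂ) (ζ : ℂ) (x t : ℝ) : Matrix (Fin 3) (Fin 3) ℂ :=
  ζ ^ 2 • !![-2 * I, 0, 0; 0, I, 0; 0, 0, I] +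
    ζ • !![0, q1 x t, q2 x t; r1 x t, 0, 0; r2 x t, 0, 0]

/-- The temporal Lax matrix V(ζ). -/
def Vmat (q1 q2 r1 r2 : ℝ → ℝ → ℂ) (ζ : ℂ) (x t : ℝ) : Matrix (Fin 3) (Fin 3) ℂ :=
  ζ ^ 4 • !![-9 * I, 0, 0; 0, 0, 0; 0, 0, 0] +
    ζ ^ 3 • !![0, 3 * q1 x t, 3 * q2 x t; 3 * r1 x t, 0, 0; 3 * r2 x t, 0, 0] +
    ζ ^ 2 • !![-I * (r1 x t * q1 x t + r2 x t * q2 x t), 0, 0;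
               0, I * (r1 x t * q1 x t), I * (r1 x t * q2 x t);
               0, I * (r2 x t * q1 x t), I * (r2 x t * q2 x t)] +
    ζ • !![0, I * pdx q1 x t + (2 / 3) * (r1 x t * q1 x t + r2 x t * q2 x t) * q1 x t,
              I * pdx q2 x t + (2 / 3) * (r1 x t * q1 x t + r2 x t * q2 x t) * q2 x t;
           -I * pdx r1 x t + (2 / 3) * (r1 x t * q1 x t + r2 x t * q2 x t) * r1 x t, 0, 0;
           -I * pdx r2 x t + (2 / 3) * (r1 x t * q1 x t + r2 x t * q2 x t) * r2 x t, 0, 0]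

theorem hasDerivAt_pdx {f : ℝ → ℝ → ℂ}
    (hf : ContDiff ℝ (⊤ : ℕ∞) (fun p : ℝ × ℝ => f p.1 p.2)) (x t : ℝ) :
    HasDerivAt (fun x' => f x' t) (pdx f x t) x := by
  have h : Differentiable ℝ (fun p : ℝ × ℝ => f p.1 p.2) := hf.differentiable (by simp)
  have h' : Differentiable ℝ (fun x' : ℝ => f x' t) :=
    h.comp (differentiable_id.prodMk (differentiable_const t))
  exact (h' x).hasDerivAt

theorem hasDerivAt_pdt {f : ℝ → ℝ → ℂ}
    (hf : ContDiff ℝ (⊤ : ℕ∞) (fun p : ℝ × ℝ => f p.1 p.2)) (x t : ℝ) :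
    HasDerivAt (fun t' => f x t') (pdt f x t) t := by
  have h : Differentiable ℝ (fun p : ℝ × ℝ => f p.1 p.2) := hf.differentiable (by simp)
  have h' : Differentiable ℝ (fun t' : ℝ => f x t') :=
    h.comp ((differentiable_const x).prodMk differentiable_id)
  exact (h' t).hasDerivAt

theorem pdx_eq_of_hasDerivAt {f g : ℝ → ℝ → ℂ} (hfg : f = g) {x t : ℝ} {f' : ℂ}
    (hg : HasDerivAt (fun x' => g x' t) f' x) : pdx f x t = f' := by
  subst hfg
  exact hg.deriv

set_option maxHeartbeats 2000000 in
/-- the elementary Darboux matrix T₂ for the conjugate system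
satisfies ∂ₜT₂ = VT₂ − T₂V̂. -/
theorem conjugate_darboux_t_equation
    (q1 q2 r1 r2 : ℝ → ℝ → ℂ)
    (hq1 : ContDiff ℝ (⊤ : ℕ∞) (fun p : ℝ × ℝ => q1 p.1 p.2))
    (hq2 : ContDiff ℝ (⊤ : ℕ∞) (fun p : ℝ × ℝ => q2 p.1 p.2))
    (hr1 : ContDiff ℝ (⊤ : ℕ∞) (fun p : ℝ × ℝ => r1 p.1 p.2))
    (hr2 : ContDiff ℝ (⊤ : ℕ∞) (fun p : ℝ × ℝ => r2 p.1 p.2))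
    (hzc : ∀ ζ : ℂ, ∀ x t : ℝ,
      Mpdt (fun x t => Umat q1 q2 r1 r2 ζ x t) x t
        - Mpdx (fun x t => Vmat q1 q2 r1 r2 ζ x t) x t
        + Umat q1 q2 r1 r2 ζ x t * Vmat q1 q2 r1 r2 ζ x t
        - Vmat q1 q2 r1 r2 ζ x t * Umat q1 q2 r1 r2 ζ x t = 0)
    (ζ₂ : ℂ) (hζ₂ : ζ₂ ≠ 0)
    (χ1 χ2 χ3 : ℝ → ℝ → ℂ)
    (hχ1 : ContDiff ℝ (⊤ : ℕ∞) (fun p : ℝ × ℝ => χ1 p.1 p.2))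
    (hχ2 : ContDiff ℝ (⊤ : ℕ∞) (fun p : ℝ × ℝ => χ2 p.1 p.2))
    (hχ3 : ContDiff ℝ (⊤ : ℕ∞) (fun p : ℝ × ℝ => χ3 p.1 p.2))
    (hχ1ne : ∀ x t : ℝ, χ1 x t ≠ 0)
    (hχ2ne : ∀ x t : ℝ, χ2 x t ≠ 0)
    (hodex : ∀ x t : ℝ,
      -(vpdx (fun x t => ![χ1 x t, χ2 x t, χ3 x t]) x t) =
        Matrix.vecMul ![χ1 x t, χ2 x t, χ3 x t] (Umat q1 q2 r1 r2 ζ₂ x t))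
    (hodet : ∀ x t : ℝ,
      -(vpdt (fun x t => ![χ1 x t, χ2 x t, χ3 x t]) x t) =
        Matrix.vecMul ![χ1 x t, χ2 x t, χ3 x t] (Vmat q1 q2 r1 r2 ζ₂ x t))
    (R2 : ℝ → ℝ → ℂ)
    (hR2smooth : ContDiff ℝ (⊤ : ℕ∞) (fun p : ℝ × ℝ => R2 p.1 p.2))
    (hR2x : ∀ x t : ℝ, pdx R2 x t = r2 x t)
    (hR2t : ∀ x t : ℝ, pdt R2 x t =
      -I * pdx r2 x t + (2 / 3) * (r1 x t * q1 x t + r2 x t * q2 x t) * r2 x t)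
    -- entries of the Darboux matrix
    (ah bh ch dh : ℝ → ℝ → ℂ)
    (hah : ah = fun x t => -(χ2 x t) / (ζ₂ * χ1 x t))
    (hbh : bh = fun x t => -(χ1 x t + ζ₂ * R2 x t * χ3 x t) / (ζ₂ * χ2 x t))
    (hch : ch = fun x t => -(χ3 x t) / χ2 x t)
    (hdh : dh = fun x t => R2 x t)
    (T2 : ℂ → ℝ → ℝ → Matrix (Fin 3) (Fin 3) ℂ)
    (hT2 : T2 = fun ζ x t =>
      !![ah x t * ζ, 1, 0;
         1, bh x t * ζ, ch x t * ζ;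
         0, dh x t * ζ, ζ])
    -- transformed potentials
    (q1h q2h r1h r2h : ℝ → ℝ → ℂ)
    (hq1h : q1h = fun x t =>
      (q1 x t * (χ1 x t) ^ 2 + 3 * I * ζ₂ * χ1 x t * χ2 x t
        + ζ₂ * χ1 x t * R2 x t * (q1 x t * χ3 x t - χ2 x t * q2 x t)) / (χ2 x t) ^ 2)
    (hr1h : r1h = fun x t =>
      ((r1 x t * χ2 x t + r2 x t * χ3 x t) * χ2 x t - 3 * I * ζ₂ * χ1 x t * χ2 x t)
        / (χ1 x t) ^ 2)
    (hr2h : r2h = fun x t =>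
      ((3 * I * R2 x t * ζ₂ ^ 2 - r2 x t) * χ1 x t * χ2 x t
        - ζ₂ * χ2 x t * R2 x t * (r1 x t * χ2 x t + r2 x t * χ3 x t))
        / (ζ₂ * (χ1 x t) ^ 2))
    (hq2h : q2h = fun x t =>
      (q1 x t * χ3 x t - q2 x t * χ2 x t) * ζ₂ * χ1 x t / (χ2 x t) ^ 2) :
    ∀ ζ : ℂ, ∀ x t : ℝ,
      Mpdt (fun x t => T2 ζ x t) x t =
        Vmat q1 q2 r1 r2 ζ x t * T2 ζ x t - T2 ζ x t * Vmat q1h q2h r1h r2h ζ x t := by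
  intro ζ x t
  have n1 := hχ1ne x t
  have n2 := hχ2ne x t
  have c1x := hasDerivAt_pdx hχ1 x t
  have c2x := hasDerivAt_pdx hχ2 x t
  have c3x := hasDerivAt_pdx hχ3 x t
  have Rx := hasDerivAt_pdx hR2smooth x t
  have q1x := hasDerivAt_pdx hq1 x t
  have q2x := hasDerivAt_pdx hq2 x t
  have r1x := hasDerivAt_pdx hr1 x t
  have r2x := hasDerivAt_pdx hr2 x t
  have c1t := hasDerivAt_pdt hχ1 x t
  have c2t := hasDerivAt_pdt hχ2 x t
  have c3t := hasDerivAt_pdt hχ3 x t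
  have Rt := hasDerivAt_pdt hR2smooth x t
  have hT2t : Mpdt (fun x t => T2 ζ x t) x t = !![
      -(pdt χ2 x t * χ1 x t - χ2 x t * pdt χ1 x t) / (ζ₂ * χ1 x t ^ 2) * ζ, 0, 0;
      0, -((pdt χ1 x t + ζ₂ * (pdt R2 x t * χ3 x t + R2 x t * pdt χ3 x t)) * χ2 x t
        - (χ1 x t + ζ₂ * R2 x t * χ3 x t) * pdt χ2 x t) / (ζ₂ * χ2 x t ^ 2) * ζ,
      -(pdt χ3 x t * χ2 x t - χ3 x t * pdt χ2 x t) / χ2 x t ^ 2 * ζ;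
      0, pdt R2 x t * ζ, 0] := by
    subst hT2 hah hbh hch hdh
    ext i j
    fin_cases i <;> fin_cases j <;> simp only [Mpdt, of_apply]
    · refine ((c2t.fun_neg.fun_div (c1t.const_mul ζ₂)
        (mul_ne_zero hζ₂ n1)).mul_const ζ).deriv.trans ?_
      congr 1
      field_simp
      ring
    · exact deriv_const t 1
    · exact deriv_const t 0
    · exact deriv_const t 1
    · refine (((c1t.fun_add ((Rt.const_mul ζ₂).fun_mul c3t)).fun_neg.fun_div
        (c2t.const_mul ζ₂) (mul_ne_zero hζ₂ n2)).mul_const ζ).deriv.trans ?_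
      congr 1
      field_simp
      ring
    · refine ((c3t.fun_neg.fun_div c2t n2).mul_const ζ).deriv.trans ?_
      congr 1
      field_simp
      ring
    · exact deriv_const t 0
    · exact (Rt.mul_const ζ).deriv
    · exact deriv_const t ζ
  have Q1x := (((q1x.fun_mul (c1x.fun_pow 2)).fun_add
      ((c1x.const_mul (3 * I * ζ₂)).fun_mul c2x)).fun_add
      (((c1x.const_mul ζ₂).fun_mul Rx).fun_mul ((q1x.fun_mul c3x).fun_sub (c2x.fun_mul q2x)))).fun_div
      (c2x.fun_pow 2) (pow_ne_zero 2 n2)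
  have Q2x := ((((q1x.fun_mul c3x).fun_sub (q2x.fun_mul c2x)).mul_const ζ₂).fun_mul c1x).fun_div
      (c2x.fun_pow 2) (pow_ne_zero 2 n2)
  have R1x := ((((r1x.fun_mul c2x).fun_add (r2x.fun_mul c3x)).fun_mul c2x).fun_sub
      ((c1x.const_mul (3 * I * ζ₂)).fun_mul c2x)).fun_div
      (c1x.fun_pow 2) (pow_ne_zero 2 n1)
  have R2hx := ((((((Rx.const_mul (3 * I)).mul_const (ζ₂ ^ 2)).fun_sub r2x).fun_mul
      c1x).fun_mul c2x).fun_sub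
      (((c2x.const_mul ζ₂).fun_mul Rx).fun_mul ((r1x.fun_mul c2x).fun_add (r2x.fun_mul c3x)))).fun_div
      ((c1x.fun_pow 2).const_mul ζ₂) (mul_ne_zero hζ₂ (pow_ne_zero 2 n1))
  replace Q1x := pdx_eq_of_hasDerivAt hq1h Q1x
  replace Q2x := pdx_eq_of_hasDerivAt hq2h Q2x
  replace R1x := pdx_eq_of_hasDerivAt hr1h R1x
  replace R2hx := pdx_eq_of_hasDerivAt hr2h R2hx
  have dx1 : pdx χ1 x t =
      2 * I * ζ₂ ^ 2 * χ1 x t - ζ₂ * (r1 x t * χ2 x t + r2 x t * χ3 x t) := by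
    have h := congrFun (hodex x t) 0
    simp [vpdx, Umat] at h
    rw [pdx]
    linear_combination -h
  have dx2 : pdx χ2 x t = -(I * ζ₂ ^ 2 * χ2 x t + ζ₂ * q1 x t * χ1 x t) := by
    have h := congrFun (hodex x t) 1
    simp [vpdx, Umat] at h
    rw [pdx]
    linear_combination -h
  have dx3 : pdx χ3 x t = -(I * ζ₂ ^ 2 * χ3 x t + ζ₂ * q2 x t * χ1 x t) := by
    have h := congrFun (hodex x t) 2
    simp [vpdx, Umat] at h
    rw [pdx]
    linear_combination -h
  have dt1 := congrFun (hodet x t) 0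
  have dt2 := congrFun (hodet x t) 1
  have dt3 := congrFun (hodet x t) 2
  simp only [vpdt, Pi.neg_apply, neg_eq_iff_eq_neg] at dt1 dt2 dt3
  simp [Vmat] at dt1 dt2 dt3
  change pdt χ1 x t = _ at dt1
  change pdt χ2 x t = _ at dt2
  change pdt χ3 x t = _ at dt3
  rw [hT2t, dt1, dt2, dt3, hR2t, hT2]
  simp only [Vmat, Q1x, Q2x, R1x, R2hx, dx1, dx2, dx3, hR2x]
  rw [hq1h, hq2h, hr1h, hr2h, hah, hbh, hch, hdh]
  clear * - n1 n2 hζ₂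
  dsimp only
  generalize χ1 x t = c1 at *
  generalize χ2 x t = c2 at *
  generalize χ3 x t = c3 at *
  generalize R2 x t = R
  generalize q1 x t = u1
  generalize q2 x t = u2
  generalize r1 x t = v1
  generalize r2 x t = v2
  generalize pdx q1 x t = a1
  generalize pdx q2 x t = a2
  generalize pdx r1 x t = b1
  generalize pdx r2 x t = b2
  ext i j
  fin_cases i <;> fin_cases j <;>
    simp <;> field_simp <;> ring_nf <;>
    simp only [I_sq, I_pow_three] <;> ring_nf
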